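/- Let f ∈ C([0,1]) be time-independent and let u be a classical solution of the bridge equation with forcing term f. Then for all 0 ≤ τ ≤ t one has 2∫_τ^t ‖∂ₜu(s,·)‖² ds ≤ 𝓛(0) + (2/π⁴)‖f‖², where 𝓛(0) = E(0) − 2⟨u(0,·), f⟩. -/

import Mathlib

open Real MeasureTheory

noncomputable section

/-- The `L²(0,1)` inner product `⟨u,v⟩`. -/
def ipL2 (u v : ℝ → ℝ) : ℝ := ∫ x in (0:ℝ)..1, u x * v x

/-- The squared `L²(0,1)` norm `‖u‖²`. -/
def nsqL2 (u : ℝ → ℝ) : ℝ := ∫ x in (0:ℝ)..1, (u x) ^ 2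

/-- Partial derivative in time. -/
def Dt (u : ℝ → ℝ → ℝ) : ℝ → ℝ → ℝ := fun t x => deriv (fun s => u s x) t

/-- Partial derivative in space. -/
def Dx (u : ℝ → ℝ → ℝ) : ℝ → ℝ → ℝ := fun t x => deriv (fun y => u t y) x

/-- A classical solution of the suspension-bridge equation
`∂ₜₜu + ∂ₓₓₓₓu + (p − ‖∂ₓu‖²)∂ₓₓu + ∂ₜu + k²u⁺ = f` on `[0,∞) × [0,1]`,
smooth up to the boundary, with pinned boundary conditions. -/
def IsClassicalSolution (p k : ℝ) (f u : ℝ → ℝ → ℝ) : Prop :=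
  ContDiff ℝ (⊤ : ℕ∞) (Function.uncurry u) ∧
  (∀ t ≥ (0:ℝ), ∀ x ∈ Set.Icc (0:ℝ) 1,
    Dt (Dt u) t x + Dx (Dx (Dx (Dx u))) t x
      + (p - nsqL2 (Dx u t)) * Dx (Dx u) t x
      + Dt u t x + k ^ 2 * max (u t x) 0 = f t x) ∧
  (∀ t ≥ (0:ℝ), u t 0 = 0 ∧ u t 1 = 0 ∧ Dx (Dx u) t 0 = 0 ∧ Dx (Dx u) t 1 = 0)

/-- The energy `E(t) = ‖∂ₜu‖² + ‖∂ₓₓu‖² + ½(‖∂ₓu‖² − p)² + k²‖u⁺‖²`. -/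
def energy (p k : ℝ) (u : ℝ → ℝ → ℝ) (t : ℝ) : ℝ :=
  nsqL2 (Dt u t) + nsqL2 (Dx (Dx u) t)
    + (1 / 2) * (nsqL2 (Dx u t) - p) ^ 2 + k ^ 2 * nsqL2 (fun x => max (u t x) 0)

/-- The reduced energy `𝓔(t) = ‖∂ₜu‖² + ‖∂ₓₓu‖²`. -/
def redEnergy (u : ℝ → ℝ → ℝ) (t : ℝ) : ℝ :=
  nsqL2 (Dt u t) + nsqL2 (Dx (Dx u) t)

section Calculus

variable {w : ℝ → ℝ → ℝ}

lemma hasDerivAt_fst_of_contDiff (hw : ContDiff ℝ (⊤ : ℕ∞) (Function.uncurry w)) (t x : ℝ) :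
    HasDerivAt (fun s => w s x) (fderiv ℝ (Function.uncurry w) (t, x) (1, 0)) t := by
  have h := (hw.differentiable (by simp) (t, x)).hasFDerivAt
  exact h.comp_hasDerivAt t ((hasDerivAt_id t).prodMk (hasDerivAt_const t x))

lemma hasDerivAt_snd_of_contDiff (hw : ContDiff ℝ (⊤ : ℕ∞) (Function.uncurry w)) (t x : ℝ) :
    HasDerivAt (fun y => w t y) (fderiv ℝ (Function.uncurry w) (t, x) (0, 1)) x := by
  have h := (hw.differentiable (by simp) (t, x)).hasFDerivAt
  exact h.comp_hasDerivAt x ((hasDerivAt_const x t).prodMk (hasDerivAt_id x))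

lemma uncurry_Dt (hw : ContDiff ℝ (⊤ : ℕ∞) (Function.uncurry w)) :
    Function.uncurry (Dt w) = fun z => fderiv ℝ (Function.uncurry w) z (1, 0) :=
  funext fun z => (hasDerivAt_fst_of_contDiff hw z.1 z.2).deriv

lemma uncurry_Dx (hw : ContDiff ℝ (⊤ : ℕ∞) (Function.uncurry w)) :
    Function.uncurry (Dx w) = fun z => fderiv ℝ (Function.uncurry w) z (0, 1) :=
  funext fun z => (hasDerivAt_snd_of_contDiff hw z.1 z.2).deriv

lemma contDiff_Dt (hw : ContDiff ℝ (⊤ : ℕ∞) (Function.uncurry w)) :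
    ContDiff ℝ (⊤ : ℕ∞) (Function.uncurry (Dt w)) := by
  rw [uncurry_Dt hw]
  exact (hw.fderiv_right (by simp)).clm_apply contDiff_const

lemma contDiff_Dx (hw : ContDiff ℝ (⊤ : ℕ∞) (Function.uncurry w)) :
    ContDiff ℝ (⊤ : ℕ∞) (Function.uncurry (Dx w)) := by
  rw [uncurry_Dx hw]
  exact (hw.fderiv_right (by simp)).clm_apply contDiff_const

lemma hasDerivAt_Dt (hw : ContDiff ℝ (⊤ : ℕ∞) (Function.uncurry w)) (t x : ℝ) :
    HasDerivAt (fun s => w s x) (Dt w t x) t :=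
  (hasDerivAt_fst_of_contDiff hw t x).differentiableAt.hasDerivAt

lemma hasDerivAt_Dx (hw : ContDiff ℝ (⊤ : ℕ∞) (Function.uncurry w)) (t x : ℝ) :
    HasDerivAt (w t) (Dx w t x) x :=
  (hasDerivAt_snd_of_contDiff hw t x).differentiableAt.hasDerivAt

lemma Dt_Dx_comm (hw : ContDiff ℝ (⊤ : ℕ∞) (Function.uncurry w)) : Dt (Dx w) = Dx (Dt w) := by
  funext t x
  have hd : DifferentiableAt ℝ (fderiv ℝ (Function.uncurry w)) (t, x) :=
    (hw.fderiv_right (m := (⊤ : ℕ∞)) (by simp)).differentiable (by simp) _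
  have h1 := congrFun (uncurry_Dt (contDiff_Dx hw)) (t, x)
  have h2 := congrFun (uncurry_Dx (contDiff_Dt hw)) (t, x)
  rw [uncurry_Dx hw, fderiv_clm_apply hd (by fun_prop)] at h1
  rw [uncurry_Dt hw, fderiv_clm_apply hd (by fun_prop)] at h2
  have hs : IsSymmSndFDerivAt ℝ (Function.uncurry w) (t, x) :=
    hw.contDiffAt.isSymmSndFDerivAt (by
      rw [minSmoothness_of_isRCLikeNormedField]
      exact WithTop.coe_le_coe.2 (le_top : (2 : ℕ∞) ≤ ⊤))
  have h3 := hs.eq (1, 0) (0, 1)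
  simp [Function.uncurry] at h1 h2
  rw [h1, h2]
  exact h3

lemma continuous_slice (hw : ContDiff ℝ (⊤ : ℕ∞) (Function.uncurry w)) (t : ℝ) :
    Continuous (w t) :=
  hw.continuous.comp (by fun_prop : Continuous fun x : ℝ => (t, x))

/-- Differentiation under the integral sign over the unit interval. -/
lemma hasDerivAt_integral_unitInterval {G G' : ℝ → ℝ → ℝ} (hG : ∀ t, Continuous (G t))
    (hG' : Continuous (Function.uncurry G'))
    (h : ∀ t x, HasDerivAt (fun s => G s x) (G' t x) t) (t : ℝ) :
    HasDerivAt (fun s => ∫ x in (0:ℝ)..1, G s x) (∫ x in (0:ℝ)..1, G' t x) t := by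
  obtain ⟨C, hC⟩ := ((isCompact_closedBall t 1).prod (isCompact_Icc (a := (0:ℝ)) (b := 1))
    ).exists_bound_of_continuousOn hG'.continuousOn
  refine (intervalIntegral.hasDerivAt_integral_of_dominated_loc_of_deriv_le
    (bound := fun _ => C) (Metric.ball_mem_nhds t one_pos)
    (Filter.Eventually.of_forall fun s => (hG s).aestronglyMeasurable)
    ((hG t).intervalIntegrable _ _)
    (hG'.comp (by fun_prop : Continuous fun x : ℝ => (t, x))).aestronglyMeasurable
    (Filter.Eventually.of_forall fun x hx s hs => ?_) (by simp)
    (Filter.Eventually.of_forall fun x _ s _ => h s x)).2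
  rw [Set.uIoc_of_le zero_le_one] at hx
  exact hC (s, x) ⟨Metric.ball_subset_closedBall hs, hx.1.le, hx.2⟩

lemma hasDerivAt_max_zero_sq (y : ℝ) :
    HasDerivAt (fun y : ℝ => (max y 0) ^ 2) (2 * max y 0) y := by
  rcases lt_trichotomy y 0 with hy | rfl | hy
  · rw [max_eq_right hy.le]
    refine ((hasDerivAt_const y (0:ℝ)).congr_deriv (by simp)).congr_of_eventuallyEq ?_
    filter_upwards [eventually_lt_nhds hy] with z hz
    simp [max_eq_right hz.le]
  · rw [hasDerivAt_iff_isLittleO]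
    refine Asymptotics.IsBigO.trans_isLittleO (g := fun y : ℝ => y ^ 2) ?_ ?_
    · refine Asymptotics.IsBigO.of_bound 1 (Filter.Eventually.of_forall fun y => ?_)
      rcases le_total y 0 with h | h <;> simp [h, sq_nonneg]
    · simpa using Asymptotics.isLittleO_pow_id (𝕜 := ℝ) one_lt_two
  · rw [max_eq_left hy.le]
    refine ((hasDerivAt_pow 2 y).congr_deriv (by simp)).congr_of_eventuallyEq ?_
    filter_upwards [eventually_gt_nhds hy] with z hz
    simp [max_eq_left hz.le]

lemma hasDerivAt_nsqL2 (hw : ContDiff ℝ (⊤ : ℕ∞) (Function.uncurry w)) (t : ℝ) :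
    HasDerivAt (fun s => nsqL2 (w s)) (2 * ∫ x in (0:ℝ)..1, w t x * Dt w t x) t := by
  have h := hasDerivAt_integral_unitInterval (G := fun s x => w s x ^ 2)
    (G' := fun s x => 2 * (w s x * Dt w s x)) (fun s => (continuous_slice hw s).pow 2)
    (continuous_const.fun_mul (hw.continuous.fun_mul (contDiff_Dt hw).continuous))
    (fun s x => ((hasDerivAt_Dt hw s x).pow 2).congr_deriv (by push_cast; ring)) t
  rwa [intervalIntegral.integral_const_mul] at h

lemma hasDerivAt_nsqL2_posPart (hw : ContDiff ℝ (⊤ : ℕ∞) (Function.uncurry w)) (t : ℝ) :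
    HasDerivAt (fun s => nsqL2 (fun x => max (w s x) 0))
      (2 * ∫ x in (0:ℝ)..1, max (w t x) 0 * Dt w t x) t := by
  have h := hasDerivAt_integral_unitInterval (G := fun s x => (max (w s x) 0) ^ 2)
    (G' := fun s x => 2 * (max (w s x) 0 * Dt w s x))
    (fun s => ((continuous_slice hw s).max continuous_const).pow 2)
    (continuous_const.fun_mul
      ((hw.continuous.max continuous_const).fun_mul (contDiff_Dt hw).continuous))
    (fun s x => ((hasDerivAt_max_zero_sq (w s x)).comp s (hasDerivAt_Dt hw s x)).congr_deriv
      (by ring)) t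
  rwa [intervalIntegral.integral_const_mul] at h

lemma hasDerivAt_ipL2 (hw : ContDiff ℝ (⊤ : ℕ∞) (Function.uncurry w)) {f : ℝ → ℝ}
    (hf : Continuous f) (t : ℝ) :
    HasDerivAt (fun s => ipL2 (w s) f) (∫ x in (0:ℝ)..1, f x * Dt w t x) t :=
  hasDerivAt_integral_unitInterval (G := fun s x => w s x * f x)
    (G' := fun s x => f x * Dt w s x) (fun s => (continuous_slice hw s).mul hf)
    ((hf.comp continuous_snd).mul (contDiff_Dt hw).continuous)
    (fun s x => ((hasDerivAt_Dt hw s x).mul_const (f x)).congr_deriv (mul_comm _ _)) t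

/-- Integration by parts on the unit interval with one factor vanishing at the end points. -/
lemma integral_mul_deriv_of_boundary_zero {g g' h h' : ℝ → ℝ} (hg : ∀ x, HasDerivAt g (g' x) x)
    (hh : ∀ x, HasDerivAt h (h' x) x) (hg' : Continuous g') (hh' : Continuous h')
    (h0 : g 0 * h 0 = 0) (h1 : g 1 * h 1 = 0) :
    ∫ x in (0:ℝ)..1, g x * h' x = -∫ x in (0:ℝ)..1, g' x * h x := by
  rw [intervalIntegral.integral_mul_deriv_eq_deriv_mul (fun x _ => hg x) (fun x _ => hh x)
    (hg'.intervalIntegrable _ _) (hh'.intervalIntegrable _ _), h0, h1]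
  simp

end Calculus

/-- Poincaré inequality for functions vanishing at the end points. -/
lemma sq_mul_nsqL2_le_nsqL2_deriv {v v' : ℝ → ℝ} (hv : ∀ x, HasDerivAt v (v' x) x)
    (hv' : Continuous v') (h0 : v 0 = 0) (h1 : v 1 = 0) {l : ℝ} (hl : 0 ≤ l) (hlpi : l < π) :
    l ^ 2 * nsqL2 v ≤ nsqL2 v' := by
  have hvc : Continuous v := continuous_iff_continuousAt.2 fun x => (hv x).continuousAt
  have hcos : ∀ x ∈ Set.Icc (0:ℝ) 1, cos (l * (1 / 2 - x)) ≠ 0 := fun x hx => by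
    refine (cos_pos_of_mem_Ioo ⟨?_, ?_⟩).ne' <;> nlinarith [hx.1, hx.2]
  set g : ℝ → ℝ := fun x => l * tan (l * (1 / 2 - x)) with hg
  have hgd : ∀ x ∈ Set.Icc (0:ℝ) 1, HasDerivAt g (-l ^ 2 - g x ^ 2) x := fun x hx => by
    have hin : HasDerivAt (fun x : ℝ => l * (1 / 2 - x)) (-l) x :=
      (((hasDerivAt_id x).const_sub (1 / 2)).const_mul l).congr_deriv (by ring)
    refine (((hasDerivAt_tan (hcos x hx)).comp x hin).const_mul l).congr_deriv ?_
    rw [hg]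
    simp only [tan_eq_sin_div_cos]
    have hc := hcos x hx
    have hsc := sin_sq_add_cos_sq (l * (1 / 2 - x))
    generalize cos (l * (1 / 2 - x)) = c at hc hsc ⊢
    generalize sin (l * (1 / 2 - x)) = s at hsc ⊢
    field_simp
    linear_combination l ^ 2 * hsc
  have hgc : ContinuousOn g (Set.Icc 0 1) := fun x hx => (hgd x hx).continuousAt.continuousWithinAt
  have hIcc : Set.uIcc (0:ℝ) 1 = Set.Icc 0 1 := Set.uIcc_of_le zero_le_one
  have hint : ∫ x in (0:ℝ)..1, ((-l ^ 2 - g x ^ 2) * v x ^ 2 + g x * (2 * v x * v' x)) = 0 := by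
    rw [intervalIntegral.integral_eq_sub_of_hasDerivAt (f := fun x => g x * v x ^ 2)]
    · simp [h0, h1]
    · intro x hx
      exact ((hgd x (hIcc ▸ hx)).mul ((hv x).pow 2)).congr_deriv (by simp)
    · refine ContinuousOn.intervalIntegrable ?_
      rw [hIcc]
      fun_prop
  have hi1 : IntervalIntegrable (fun x => v' x ^ 2) volume 0 1 :=
    (hv'.pow 2).intervalIntegrable _ _
  have hi2 : IntervalIntegrable (fun x => l ^ 2 * v x ^ 2) volume 0 1 :=
    (continuous_const.mul (hvc.pow 2)).intervalIntegrable _ _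
  have hi3 : IntervalIntegrable
      (fun x => (-l ^ 2 - g x ^ 2) * v x ^ 2 + g x * (2 * v x * v' x)) volume 0 1 := by
    refine ContinuousOn.intervalIntegrable ?_
    rw [hIcc]
    fun_prop
  have hnn : 0 ≤ ∫ x in (0:ℝ)..1, (v' x - g x * v x) ^ 2 :=
    intervalIntegral.integral_nonneg zero_le_one fun x _ => sq_nonneg _
  have hexp : ∀ x, (v' x - g x * v x) ^ 2 = v' x ^ 2 - l ^ 2 * v x ^ 2
      - ((-l ^ 2 - g x ^ 2) * v x ^ 2 + g x * (2 * v x * v' x)) := fun x => by ring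
  simp_rw [hexp] at hnn
  rw [intervalIntegral.integral_sub (hi1.sub hi2) hi3, intervalIntegral.integral_sub hi1 hi2, hint,
    intervalIntegral.integral_const_mul] at hnn
  unfold nsqL2
  linarith

lemma pow_four_mul_nsqL2_le {v v' v'' : ℝ → ℝ} (hv : ∀ x, HasDerivAt v (v' x) x)
    (hv' : ∀ x, HasDerivAt v' (v'' x) x) (hv'' : Continuous v'') (h0 : v 0 = 0) (h1 : v 1 = 0)
    {l : ℝ} (hl : 0 ≤ l) (hlpi : l < π) : l ^ 4 * nsqL2 v ≤ nsqL2 v'' := by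
  have hvc : Continuous v := continuous_iff_continuousAt.2 fun x => (hv x).continuousAt
  have hvc' : Continuous v' := continuous_iff_continuousAt.2 fun x => (hv' x).continuousAt
  have hP := sq_mul_nsqL2_le_nsqL2_deriv hv hvc' h0 h1 hl hlpi
  have hparts := integral_mul_deriv_of_boundary_zero hv hv' hvc' hv'' (by simp [h0]) (by simp [h1])
  have hnn : 0 ≤ ∫ x in (0:ℝ)..1, (v'' x + l ^ 2 * v x) ^ 2 :=
    intervalIntegral.integral_nonneg zero_le_one fun x _ => sq_nonneg _
  have hexp : ∀ x, (v'' x + l ^ 2 * v x) ^ 2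
      = v'' x ^ 2 + 2 * l ^ 2 * (v x * v'' x) + l ^ 4 * v x ^ 2 := fun x => by ring
  simp_rw [hexp] at hnn
  rw [intervalIntegral.integral_add, intervalIntegral.integral_add,
    intervalIntegral.integral_const_mul, intervalIntegral.integral_const_mul, hparts] at hnn
  · unfold nsqL2 at hP ⊢
    simp_rw [← pow_two] at hnn
    nlinarith [mul_le_mul_of_nonneg_left hP (sq_nonneg l)]
  all_goals exact Continuous.intervalIntegrable (by fun_prop) _ _

lemma two_mul_mul_ipL2_le {v f : ℝ → ℝ} (hv : Continuous v) (hf : Continuous f) (c : ℝ) :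
    2 * c * ipL2 v f ≤ c ^ 2 * nsqL2 v + nsqL2 f := by
  have hnn : 0 ≤ ∫ x in (0:ℝ)..1, (c * v x - f x) ^ 2 :=
    intervalIntegral.integral_nonneg zero_le_one fun x _ => sq_nonneg _
  have hexp : ∀ x, (c * v x - f x) ^ 2 = c ^ 2 * v x ^ 2 - 2 * c * (v x * f x) + f x ^ 2 :=
    fun x => by ring
  simp_rw [hexp] at hnn
  rw [intervalIntegral.integral_add, intervalIntegral.integral_sub,
    intervalIntegral.integral_const_mul, intervalIntegral.integral_const_mul] at hnn
  · unfold ipL2 nsqL2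
    linarith
  all_goals exact Continuous.intervalIntegrable (by fun_prop) _ _

lemma nsqL2_nonneg (v : ℝ → ℝ) : 0 ≤ nsqL2 v :=
  intervalIntegral.integral_nonneg zero_le_one fun _ _ => sq_nonneg _

lemma IsClassicalSolution.Dt_boundary {p k : ℝ} {f u : ℝ → ℝ → ℝ}
    (hu : IsClassicalSolution p k f u) {t : ℝ} (ht : 0 < t) : Dt u t 0 = 0 ∧ Dt u t 1 = 0 := by
  have key : ∀ x, (∀ s ≥ (0:ℝ), u s x = 0) → Dt u t x = 0 := fun x hx => by
    have : (fun s => u s x) =ᶠ[nhds t] fun _ => 0 := by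
      filter_upwards [eventually_gt_nhds ht] with s hs using hx s hs.le
    simpa [Dt] using this.deriv_eq
  exact ⟨key 0 fun s hs => (hu.2.2 s hs).1, key 1 fun s hs => (hu.2.2 s hs).2.1⟩

lemma hasDerivAt_lyapunov_of_contDiff {p k : ℝ} {f : ℝ → ℝ} (hf : Continuous f) {u : ℝ → ℝ → ℝ}
    (hu : ContDiff ℝ (⊤ : ℕ∞) (Function.uncurry u)) (t : ℝ) :
    HasDerivAt (fun s => energy p k u s - 2 * ipL2 (u s) f)
      (2 * ((∫ x in (0:ℝ)..1, Dt u t x * Dt (Dt u) t x)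
        + (∫ x in (0:ℝ)..1, Dx (Dx u) t x * Dx (Dx (Dt u)) t x)
        + (nsqL2 (Dx u t) - p) * (∫ x in (0:ℝ)..1, Dx u t x * Dx (Dt u) t x)
        + k ^ 2 * (∫ x in (0:ℝ)..1, max (u t x) 0 * Dt u t x)
        - ∫ x in (0:ℝ)..1, f x * Dt u t x)) t := by
  have hx := contDiff_Dx hu
  have e1 := hasDerivAt_nsqL2 (contDiff_Dt hu) t
  have e2 := hasDerivAt_nsqL2 (contDiff_Dx hx) t
  have e3 := hasDerivAt_nsqL2 hx t
  rw [Dt_Dx_comm hx, Dt_Dx_comm hu] at e2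
  rw [Dt_Dx_comm hu] at e3
  exact ((((e1.add e2).add (((e3.sub_const p).pow 2).const_mul (1 / 2))).add
    ((hasDerivAt_nsqL2_posPart hu t).const_mul (k ^ 2))).sub
    ((hasDerivAt_ipL2 hu hf t).const_mul 2)).congr_deriv (by push_cast; ring)

/-- The energy identity: the Lyapunov function decays at rate `2‖∂ₜu‖²`. -/
lemma IsClassicalSolution.hasDerivAt_lyapunov {p k : ℝ} {f : ℝ → ℝ} (hf : Continuous f)
    {u : ℝ → ℝ → ℝ} (hu : IsClassicalSolution p k (fun _ x => f x) u) {t : ℝ} (ht : 0 < t) :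
    HasDerivAt (fun s => energy p k u s - 2 * ipL2 (u s) f) (-(2 * nsqL2 (Dt u t))) t := by
  obtain ⟨hs, heq, hbd⟩ := id hu
  obtain ⟨b0, b1⟩ := hu.Dt_boundary ht
  obtain ⟨-, -, c0, c1⟩ := hbd t ht.le
  have hx := contDiff_Dx hs
  have hxx := contDiff_Dx hx
  have hxxx := contDiff_Dx hxx
  have hxxxx := contDiff_Dx hxxx
  have hT := contDiff_Dt hs
  have hTT := contDiff_Dt hT
  have hTx := contDiff_Dx hT
  have hTxx := contDiff_Dx hTx
  refine (hasDerivAt_lyapunov_of_contDiff hf hs t).congr_deriv ?_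
  rw [integral_mul_deriv_of_boundary_zero (hasDerivAt_Dx hxx t) (hasDerivAt_Dx hTx t)
      (continuous_slice hxxx t) (continuous_slice hTxx t) (by simp [c0]) (by simp [c1]),
    integral_mul_deriv_of_boundary_zero (hasDerivAt_Dx hxxx t) (hasDerivAt_Dx hT t)
      (continuous_slice hxxxx t) (continuous_slice hTx t) (by simp [b0]) (by simp [b1]),
    integral_mul_deriv_of_boundary_zero (hasDerivAt_Dx hx t) (hasDerivAt_Dx hT t)
      (continuous_slice hxx t) (continuous_slice hTx t) (by simp [b0]) (by simp [b1])]
  have q0 := continuous_slice hs t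
  have q2 := continuous_slice hxx t
  have q4 := continuous_slice hxxxx t
  have qT := continuous_slice hT t
  have qTT := continuous_slice hTT t
  have hI : nsqL2 (Dt u t) = ∫ x in (0:ℝ)..1, (f x * Dt u t x - Dt u t x * Dt (Dt u) t x
      - Dx (Dx (Dx (Dx u))) t x * Dt u t x
      - (p - nsqL2 (Dx u t)) * (Dx (Dx u) t x * Dt u t x)
      - k ^ 2 * (max (u t x) 0 * Dt u t x)) := by
    refine intervalIntegral.integral_congr fun x hx => ?_
    rw [Set.uIcc_of_le zero_le_one] at hx
    have := heq t ht.le x hx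
    simp only at this ⊢
    rw [← this]
    ring
  rw [hI, intervalIntegral.integral_sub, intervalIntegral.integral_sub,
    intervalIntegral.integral_sub, intervalIntegral.integral_sub,
    intervalIntegral.integral_const_mul, intervalIntegral.integral_const_mul]
  · ring
  all_goals exact Continuous.intervalIntegrable (by fun_prop) _ _

/-- Lower bound for the Lyapunov function. -/
lemma IsClassicalSolution.neg_lyapunov_le {p k : ℝ} {f : ℝ → ℝ} (hf : Continuous f)
    {u : ℝ → ℝ → ℝ} (hu : IsClassicalSolution p k (fun _ x => f x) u) {t : ℝ} (ht : 0 ≤ t) :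
    -(energy p k u t - 2 * ipL2 (u t) f) ≤ 2 / π ^ 4 * nsqL2 f := by
  obtain ⟨hs, -, hbd⟩ := hu
  obtain ⟨b0, b1, -, -⟩ := hbd t ht
  have hx := contDiff_Dx hs
  have hpi : 0 < π ^ 4 := by positivity
  have hP := pow_four_mul_nsqL2_le (hasDerivAt_Dx hs t) (hasDerivAt_Dx hx t)
    (continuous_slice (contDiff_Dx hx) t) b0 b1 (l := 9 / 10 * π) (by positivity)
    (by linarith [pi_pos])
  have hY := two_mul_mul_ipL2_le (continuous_slice hs t) hf (π ^ 4 / 2)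
  have hY' : 2 * ipL2 (u t) f ≤ π ^ 4 / 2 * nsqL2 (u t) + 2 / π ^ 4 * nsqL2 f := by
    have := mul_le_mul_of_nonneg_left hY (by positivity : 0 ≤ 2 / π ^ 4)
    field_simp at this ⊢
    linarith
  have hn := mul_nonneg hpi.le (nsqL2_nonneg (u t))
  have hp : 0 ≤ k ^ 2 * nsqL2 (fun x => max (u t x) 0) :=
    mul_nonneg (sq_nonneg k) (nsqL2_nonneg _)
  unfold energy
  nlinarith [nsqL2_nonneg (Dt u t), sq_nonneg (nsqL2 (Dx u t) - p)]

/-- Integrated dissipation bound: for a time-independent forcing `f` and all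
`0 ≤ τ ≤ t`, `2∫_τ^t ‖∂ₜu(s,·)‖² ds ≤ 𝓛(0) + (2/π⁴)‖f‖²`, where
`𝓛(0) = E(0) − 2⟨u(0,·), f⟩`. -/
theorem dissipation_integral_bound (p k : ℝ) (f : ℝ → ℝ) (hf : Continuous f)
    (u : ℝ → ℝ → ℝ) (hu : IsClassicalSolution p k (fun _ x => f x) u) :
    ∀ τ t : ℝ, 0 ≤ τ → τ ≤ t →
      2 * (∫ s in τ..t, nsqL2 (Dt u s)) ≤
        (energy p k u 0 - 2 * ipL2 (u 0) f) + (2 / π ^ 4) * nsqL2 f := by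
  intro τ t hτ ht
  have ht0 := hτ.trans ht
  have hcont : Continuous fun s => nsqL2 (Dt u s) := continuous_iff_continuousAt.2 fun s =>
    (hasDerivAt_nsqL2 (contDiff_Dt hu.1) s).continuousAt
  have hFTC := intervalIntegral.integral_eq_sub_of_hasDerivAt_of_le ht0
    (f := fun s => energy p k u s - 2 * ipL2 (u s) f) (f' := fun s => -(2 * nsqL2 (Dt u s)))
    (fun s _ => (hasDerivAt_lyapunov_of_contDiff hf hu.1 s).continuousAt.continuousWithinAt)
    (fun s hs => hu.hasDerivAt_lyapunov hf hs.1)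
    ((continuous_const.mul hcont).neg.intervalIntegrable _ _)
  rw [intervalIntegral.integral_neg, intervalIntegral.integral_const_mul] at hFTC
  have hmono : ∫ s in τ..t, nsqL2 (Dt u s) ≤ ∫ s in (0:ℝ)..t, nsqL2 (Dt u s) :=
    intervalIntegral.integral_mono_interval hτ ht le_rfl
      (Filter.Eventually.of_forall fun s => nsqL2_nonneg _) (hcont.intervalIntegrable _ _)
  have hlow := hu.neg_lyapunov_le hf ht0
  linarith
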